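/- arXiv:2204.05851 — 5 statements merged into one kernel-verified Lean document; each statement's English description precedes it below -/
import Mathlib

section
/- Let R be a commutative ring, let t and s be units of R, and let M be an R-module. Define the ternary operation [x,y,z] = t·y + s·z − t·s·x on M. Then this operation is a horizontal tribracket on M, i.e.: (i) for all x,y,z ∈ M there exist unique elements u, v, w ∈ M with [x,y,u] = z, [x,v,y] = z and [w,x,y] = z; and (ii) for all x,y,z,w ∈ M, [y,[x,y,z],[x,y,w]] = [z,[x,y,z],[x,z,w]] = [w,[x,y,w],[x,z,w]]. -/
/-- Multiplication by a unit of the ring is a bijection of the module. -/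
theorem IsUnit.existsUnique_smul_eq {R M : Type*} [Monoid R] [MulAction R M]
    {a : R} (ha : IsUnit a) (b : M) : ∃! u : M, a • u = b := by
  obtain ⟨a, rfl⟩ := ha
  exact (MulAction.bijective a).existsUnique b

/-- The Alexander tribracket `[x,y,z] = t•y + s•z - (t*s)•x` on a module `M`
over a commutative ring `R`, with `t, s` units of `R`, is a horizontal
tribracket: it satisfies the invertibility axiom (i) and the tribracket
identity (ii). -/
theorem alexander_tribracket_is_horizontal_tribracket
    (R : Type*) [CommRing R] (M : Type*) [AddCommGroup M] [Module R M]
    (t s : R) (ht : IsUnit t) (hs : IsUnit s) :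
    ((∀ x y z : M,
        (∃! u : M, t • y + s • u - (t * s) • x = z) ∧
        (∃! v : M, t • v + s • y - (t * s) • x = z) ∧
        (∃! w : M, t • x + s • y - (t * s) • w = z)) ∧
     (∀ x y z w : M,
        (t • (t • y + s • z - (t * s) • x) + s • (t • y + s • w - (t * s) • x)
            - (t * s) • y =
         t • (t • y + s • z - (t * s) • x) + s • (t • z + s • w - (t * s) • x)
            - (t * s) • z) ∧
        (t • (t • y + s • z - (t * s) • x) + s • (t • z + s • w - (t * s) • x)
            - (t * s) • z =
         t • (t • y + s • w - (t * s) • x) + s • (t • z + s • w - (t * s) • x)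
            - (t * s) • w))) := by
  refine ⟨fun x y z => ⟨?_, ?_, ?_⟩, fun x y z w => ⟨by module, by module⟩⟩
  · refine (existsUnique_congr fun u => ?_).mp
      (hs.existsUnique_smul_eq (z + (t * s) • x - t • y))
    grind
  · refine (existsUnique_congr fun v => ?_).mp
      (ht.existsUnique_smul_eq (z + (t * s) • x - s • y))
    grind
  · refine (existsUnique_congr fun w => ?_).mp
      ((ht.mul hs).existsUnique_smul_eq (t • x + s • y - z))
    grind
end

section
/- Let R be a commutative ring, let t, s be units of R satisfying 2·t·s = t² + s², and let M be an R-module with Alexander tribracket [x,y,z] = t·y + s·z − t·s·x. Then the Δ-identity holds: for all x,y,z,w ∈ M, [y,[x,y,z],[x,w,y]] = [z,[x,z,w],[x,y,z]] = [w,[x,w,y],[x,z,w]]. -/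
/-- If `2ts = t² + s²` then the Alexander tribracket `[x,y,z] = t•y + s•z -
(t*s)•x` on an `R`-module `M` satisfies the Δ-identity. -/
theorem alexander_tribracket_delta_identity
    (R : Type*) [CommRing R] (M : Type*) [AddCommGroup M] [Module R M]
    (t s : R) (ht : IsUnit t) (hs : IsUnit s)
    (h : 2 * (t * s) = t ^ 2 + s ^ 2) (x y z w : M) :
    (t • (t • y + s • z - (t * s) • x) + s • (t • w + s • y - (t * s) • x)
        - (t * s) • y =
      t • (t • z + s • w - (t * s) • x) + s • (t • y + s • z - (t * s) • x)
        - (t * s) • z) ∧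
    (t • (t • z + s • w - (t * s) • x) + s • (t • y + s • z - (t * s) • x)
        - (t * s) • z =
      t • (t • w + s • y - (t * s) • x) + s • (t • z + s • w - (t * s) • x)
        - (t * s) • w) := by
  constructor
  · linear_combination (norm := module) h • (z - y)
  · linear_combination (norm := module) h • (w - z)
end

section
/- Let R be a commutative ring and let t, s be units of R. The Alexander tribracket [x,y,z] = t·y + s·z − t·s·x on M = R satisfies the Δ-identity, i.e. [y,[x,y,z],[x,w,y]] = [z,[x,z,w],[x,y,z]] = [w,[x,w,y],[x,z,w]] for all x,y,z,w ∈ R, if and only if t² + s² = 2·t·s. -/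
/-- The Alexander tribracket `[x,y,z] = t*y + s*z - t*s*x` on `M = R`
satisfies the Δ-identity iff `t² + s² = 2ts`. -/
theorem alexander_tribracket_delta_identity_iff
    (R : Type*) [CommRing R] (t s : R) (ht : IsUnit t) (hs : IsUnit s) :
    (∀ x y z w : R,
      (t * (t * y + s * z - t * s * x) + s * (t * w + s * y - t * s * x)
          - t * s * y =
        t * (t * z + s * w - t * s * x) + s * (t * y + s * z - t * s * x)
          - t * s * z) ∧
      (t * (t * z + s * w - t * s * x) + s * (t * y + s * z - t * s * x)
          - t * s * z =
        t * (t * w + s * y - t * s * x) + s * (t * z + s * w - t * s * x)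
          - t * s * w)) ↔
    t ^ 2 + s ^ 2 = 2 * (t * s) := by
  constructor
  · intro h
    linear_combination (h 0 1 0 0).1
  · intro h x y z w
    constructor
    · linear_combination (y - z) * h
    · linear_combination (z - w) * h
end

section
/- A ternary operation f : (ZMod 2)³ → ZMod 2 is a horizontal tribracket (i.e. satisfies axiom (i): for all x,y,z there exist unique u,v,w with f(x,y,u) = z, f(x,v,y) = z, f(w,x,y) = z; and axiom (ii): for all x,y,z,w, f(y,f(x,y,z),f(x,y,w)) = f(z,f(x,y,z),f(x,z,w)) = f(w,f(x,y,w),f(x,z,w))) if and only if f(x,y,z) = x + y + z for all x,y,z, or f(x,y,z) = x + y + z + 1 for all x,y,z. In particular there are exactly two tribracket structures on a two-element set. -/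
/-- A ternary operation on a horizontal tribracket. -/
def IsHorizontalTribracket {X : Type*} (f : X → X → X → X) : Prop :=
  (∀ x y z : X,
      (∃! u : X, f x y u = z) ∧ (∃! v : X, f x v y = z) ∧
      (∃! w : X, f w x y = z)) ∧
  (∀ x y z w : X,
      f y (f x y z) (f x y w) = f z (f x y z) (f x z w) ∧
      f z (f x y z) (f x z w) = f w (f x y w) (f x z w))

theorem ZMod.two_apply_eq_of_injective :
    ∀ g : ZMod 2 → ZMod 2, Function.Injective g → ∀ z, g z = g 0 + z := by
  decide

theorem IsHorizontalTribracket.apply_eq {f : ZMod 2 → ZMod 2 → ZMod 2 → ZMod 2}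
    (hf : IsHorizontalTribracket f) (x y z : ZMod 2) :
    f x y z = f 0 0 0 + x + y + z := by
  have right : Function.Injective (fun u => f x y u) :=
    fun a b h => (hf.1 x y (f x y b)).1.unique h rfl
  have middle : Function.Injective (fun v => f x v 0) :=
    fun a b h => (hf.1 x 0 (f x b 0)).2.1.unique h rfl
  have left : Function.Injective (fun w => f w 0 0) :=
    fun a b h => (hf.1 0 0 (f b 0 0)).2.2.unique h rfl
  have hz := ZMod.two_apply_eq_of_injective _ right z
  have hy := ZMod.two_apply_eq_of_injective _ middle y
  have hx := ZMod.two_apply_eq_of_injective _ left x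
  rw [hz, hy, hx]

theorem isHorizontalTribracket_add_const (c : ZMod 2) :
    IsHorizontalTribracket (fun x y z : ZMod 2 => c + x + y + z) := by
  unfold IsHorizontalTribracket ExistsUnique
  revert c
  decide

/-- A horizontal tribracket on `ZMod 2` is determined by its value at the origin, which is
arbitrary. -/
def horizontalTribracketEquiv :
    {g : ZMod 2 → ZMod 2 → ZMod 2 → ZMod 2 // IsHorizontalTribracket g} ≃ ZMod 2 where
  toFun g := g.1 0 0 0
  invFun c := ⟨fun x y z => c + x + y + z, isHorizontalTribracket_add_const c⟩
  left_inv g := Subtype.ext <| by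
    funext x y z
    exact (g.2.apply_eq x y z).symm
  right_inv c := by simp

/-- A ternary operation `f` on `ZMod 2` is a horizontal tribracket iff
`f x y z = x + y + z` for all `x,y,z` or `f x y z = x + y + z + 1` for all
`x,y,z`; in particular there are exactly two tribracket structures on a
two-element set. -/
theorem tribrackets_on_two_element_set
    (f : ZMod 2 → ZMod 2 → ZMod 2 → ZMod 2) :
    (IsHorizontalTribracket f ↔
      (∀ x y z : ZMod 2, f x y z = x + y + z) ∨
      (∀ x y z : ZMod 2, f x y z = x + y + z + 1)) ∧
    Nat.card {g : ZMod 2 → ZMod 2 → ZMod 2 → ZMod 2 //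
      IsHorizontalTribracket g} = 2 := by
  refine ⟨⟨fun hf => ?_, ?_⟩, ?_⟩
  · have h01 : ∀ c : ZMod 2, c = 0 ∨ c = 1 := by decide
    rcases h01 (f 0 0 0) with h | h
    · left
      intro x y z
      rw [hf.apply_eq, h]
      ring
    · right
      intro x y z
      rw [hf.apply_eq, h]
      ring
  · rintro (h | h)
    · convert isHorizontalTribracket_add_const 0 using 4 with x y z
      rw [h]
      ring
    · convert isHorizontalTribracket_add_const 1 using 4 with x y z
      rw [h]
      ring
  · rw [Nat.card_congr horizontalTribracketEquiv, Nat.card_zmod]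
end

section
/- Let R be a commutative ring and let t, s be units of R with t² + s² = 2·t·s. Then the solution set of the trefoil coloring system with respect to the Alexander tribracket is a free R-module of rank 2 parametrized by (x, w): for every pair (x, w) ∈ R × R there exist unique a, y, z ∈ R such that a + t·s·x = t·y + s·z, a + t·s·x = t·z + s·w, and a + t·s·x = s·y + t·w. -/
/-- For an Alexander Δ-tribracket (`t² + s² = 2ts`), the trefoil coloring
system has solution set freely parametrized by `(x, w)`: for each `(x, w)`
there are unique `a, y, z` solving the three crossing equations. -/
theorem trefoil_coloring_system_delta_tribracket
    (R : Type*) [CommRing R] (t s : R) (ht : IsUnit t) (hs : IsUnit s)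
    (h : t ^ 2 + s ^ 2 = 2 * (t * s)) (x w : R) :
    ∃! p : R × R × R,
      p.1 + t * s * x = t * p.2.1 + s * p.2.2 ∧
      p.1 + t * s * x = t * p.2.2 + s * w ∧
      p.1 + t * s * x = s * p.2.1 + t * w := by
  refine ⟨((t + s) * w - t * s * x, w, w), ⟨by ring, by ring, by ring⟩, ?_⟩
  rintro ⟨a, y, z⟩ ⟨h₁, h₂, h₃⟩
  dsimp only at h₁ h₂ h₃
  have hy : y = w := by
    refine (ht.mul hs).mul_left_cancel ?_
    linear_combination (w - y) * h - t * h₁ + (t - s) * h₃ + s * h₂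
  subst hy
  have hz : z = y := by
    refine ht.mul_left_cancel ?_
    linear_combination h₃ - h₂
  subst hz
  have ha : a = (t + s) * z - t * s * x := by linear_combination h₁
  rw [ha]
end
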